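/- arXiv:2109.06910 — 4 statements merged into one kernel-verified Lean document; each statement's English description precedes it below -/
import Mathlib

section
/- Let Ω ⊆ ℝ² be open, let u₁ : ℝ² → ℝ be differentiable on Ω, let u₂, f₁, K₁, λ₁, R, φ : ℝ² → ℝ be continuous on Ω with φ ≥ 0 on Ω, and suppose that f₁(x)‖∇u₁(x)‖ ≤ K₁(x) + λ₁(x)R(x) + φ(x)(u₂(x) − u₁(x)) for all x ∈ Ω. Let T ≥ 0 and let y : [0,T] → Ω be continuously differentiable with ‖y′(s)‖ ≤ f₁(y(s)) for all s ∈ [0,T]. Define Φ(s) = ∫₀ˢ φ(y(τ)) dτ. Then u₁(y(0)) ≤ ∫₀ᵀ e^{−Φ(s)} [K₁(y(s)) + λ₁(y(s))R(y(s)) + φ(y(s)) u₂(y(s))] ds + e^{−Φ(T)} u₁(y(T)). -/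
open Set

/-- Verification (subsolution) inequality for mode 1 of the piecewise-deterministic
breakdown model: a classical subsolution of
`f₁ |∇u₁| = K₁ + λ₁ R + φ (u₂ - u₁)` bounds from below the discounted cost of any
admissible trajectory moving at speed at most `f₁`. -/
theorem mode1_verification_inequality
    (Ω : Set (EuclideanSpace ℝ (Fin 2))) (hΩ : IsOpen Ω)
    (u₁ u₂ f₁ K₁ lam₁ R φ : EuclideanSpace ℝ (Fin 2) → ℝ)
    (hu₁ : ∀ x ∈ Ω, DifferentiableAt ℝ u₁ x)
    (hu₂ : ContinuousOn u₂ Ω) (hf₁ : ContinuousOn f₁ Ω)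
    (hK₁ : ContinuousOn K₁ Ω) (hlam₁ : ContinuousOn lam₁ Ω)
    (hR : ContinuousOn R Ω) (hφ : ContinuousOn φ Ω)
    (hφ0 : ∀ x ∈ Ω, 0 ≤ φ x)
    (hsub : ∀ x ∈ Ω,
      f₁ x * ‖gradient u₁ x‖ ≤ K₁ x + lam₁ x * R x + φ x * (u₂ x - u₁ x))
    (T : ℝ) (hT : 0 ≤ T)
    (y y' : ℝ → EuclideanSpace ℝ (Fin 2))
    (hyΩ : ∀ s ∈ Set.Icc (0:ℝ) T, y s ∈ Ω)
    (hy : ∀ s ∈ Set.Icc (0:ℝ) T, HasDerivAt y (y' s) s)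
    (hy' : ContinuousOn y' (Set.Icc 0 T))
    (hspeed : ∀ s ∈ Set.Icc (0:ℝ) T, ‖y' s‖ ≤ f₁ (y s))
    (Φ : ℝ → ℝ) (hΦ : ∀ s, Φ s = ∫ τ in (0:ℝ)..s, φ (y τ)) :
    u₁ (y 0) ≤
      (∫ s in (0:ℝ)..T,
        Real.exp (-Φ s) * (K₁ (y s) + lam₁ (y s) * R (y s) + φ (y s) * u₂ (y s)))
      + Real.exp (-Φ T) * u₁ (y T) := by
  have hyc : ContinuousOn y (Icc 0 T) := fun s hs => (hy s hs).continuousAt.continuousWithinAt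
  have hφy : ContinuousOn (fun s => φ (y s)) (Icc 0 T) := hφ.comp hyc hyΩ
  have hu₁y : ContinuousOn (fun s => u₁ (y s)) (Icc 0 T) := fun s hs =>
    ((hu₁ _ (hyΩ s hs)).continuousAt.comp (hy s hs).continuousAt).continuousWithinAt
  have hΦeq : Φ = fun s => ∫ τ in (0:ℝ)..s, φ (y τ) := funext hΦ
  have hΦc : ContinuousOn Φ (Icc 0 T) := by
    rw [hΦeq, ← uIcc_of_le hT]
    apply intervalIntegral.continuousOn_primitive_interval
    rw [uIcc_of_le hT]
    exact hφy.integrableOn_Icc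
  have hexp : ContinuousOn (fun s => Real.exp (-Φ s)) (Icc 0 T) := hΦc.neg.rexp
  have hΦd : ∀ s ∈ Ioo (0:ℝ) T, HasDerivAt Φ (φ (y s)) s := by
    intro s hs
    rw [hΦeq]
    refine intervalIntegral.integral_hasDerivAt_right ?_ ?_ ?_
    · apply ContinuousOn.intervalIntegrable_of_Icc hs.1.le
      exact hφy.mono (Icc_subset_Icc_right hs.2.le)
    · exact (hφy.mono Ioo_subset_Icc_self).stronglyMeasurableAtFilter isOpen_Ioo s hs
    · exact hφy.continuousAt (Icc_mem_nhds hs.1 hs.2)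
  have hcost : ContinuousOn (fun s => Real.exp (-Φ s) *
      (K₁ (y s) + lam₁ (y s) * R (y s) + φ (y s) * u₂ (y s))) (Icc 0 T) :=
    hexp.mul (((hK₁.comp hyc hyΩ).add ((hlam₁.comp hyc hyΩ).mul (hR.comp hyc hyΩ))).add
      (hφy.mul (hu₂.comp hyc hyΩ)))
  have hderiv : ∀ s ∈ Ioo (0:ℝ) T, HasDerivAt (fun s => -(Real.exp (-Φ s) * u₁ (y s)))
      (-(Real.exp (-Φ s) * -φ (y s) * u₁ (y s) +
        Real.exp (-Φ s) * fderiv ℝ u₁ (y s) (y' s))) s := by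
    intro s hs
    have hs' := Ioo_subset_Icc_self hs
    exact ((hΦd s hs).neg.exp.mul
      ((hu₁ _ (hyΩ s hs')).hasFDerivAt.comp_hasDerivAt s (hy s hs'))).neg
  have key := intervalIntegral.sub_le_integral_of_hasDeriv_right_of_le hT
    (hexp.mul hu₁y).neg (fun s hs => (hderiv s hs).hasDerivWithinAt)
    hcost.integrableOn_Icc (by
      intro s hs
      have hs' := Ioo_subset_Icc_self hs
      have hgrad : ‖gradient u₁ (y s)‖ = ‖fderiv ℝ u₁ (y s)‖ := by
        simp [gradient]
      have hslope : -(fderiv ℝ u₁ (y s) (y' s)) ≤ f₁ (y s) * ‖gradient u₁ (y s)‖ :=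
        calc -(fderiv ℝ u₁ (y s) (y' s)) ≤ ‖fderiv ℝ u₁ (y s) (y' s)‖ := neg_le_abs _
          _ ≤ ‖fderiv ℝ u₁ (y s)‖ * ‖y' s‖ := (fderiv ℝ u₁ (y s)).le_opNorm _
          _ ≤ ‖fderiv ℝ u₁ (y s)‖ * f₁ (y s) := by gcongr; exact hspeed s hs'
          _ = f₁ (y s) * ‖gradient u₁ (y s)‖ := by rw [hgrad, mul_comm]
      have hrate : φ (y s) * u₁ (y s) - fderiv ℝ u₁ (y s) (y' s) ≤
          K₁ (y s) + lam₁ (y s) * R (y s) + φ (y s) * u₂ (y s) := by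
        linarith [hsub _ (hyΩ s hs')]
      have := mul_le_mul_of_nonneg_left hrate (Real.exp_pos (-Φ s)).le
      linarith)
  have hΦ0 : Φ 0 = 0 := by simp [hΦ]
  simp only [Pi.neg_apply, Pi.mul_apply, hΦ0, neg_zero, Real.exp_zero, one_mul] at key
  linarith
end

section
/- Let Ω ⊆ ℝ² be open, let u₂ : ℝ² → ℝ be differentiable on Ω, let u₁, f₂, K₂, λ₂, R : ℝ² → ℝ be continuous on Ω with λ₂ ≥ 0 on Ω, and suppose that f₂(x)‖∇u₂(x)‖ ≤ K₂(x) + λ₂(x)(R(x) + u₁(x) − u₂(x)) for all x ∈ Ω. Let T ≥ 0 and let y : [0,T] → Ω be continuously differentiable with ‖y′(s)‖ ≤ f₂(y(s)) for all s ∈ [0,T]. Define Λ(s) = ∫₀ˢ λ₂(y(τ)) dτ. Then u₂(y(0)) ≤ ∫₀ᵀ e^{−Λ(s)} [K₂(y(s)) + λ₂(y(s))(R(y(s)) + u₁(y(s)))] ds + e^{−Λ(T)} u₂(y(T)). -/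
open Set

/-- Verification (subsolution) inequality for mode 2 of the piecewise-deterministic
breakdown model: a classical subsolution of
`f₂ |∇u₂| = K₂ + λ₂ (R + u₁ - u₂)` bounds from below the discounted cost of any
admissible trajectory moving at speed at most `f₂`. -/
theorem mode2_verification_inequality
    (Ω : Set (EuclideanSpace ℝ (Fin 2))) (hΩ : IsOpen Ω)
    (u₂ u₁ f₂ K₂ lam₂ R : EuclideanSpace ℝ (Fin 2) → ℝ)
    (hu₂ : ∀ x ∈ Ω, DifferentiableAt ℝ u₂ x)
    (hu₁ : ContinuousOn u₁ Ω) (hf₂ : ContinuousOn f₂ Ω)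
    (hK₂ : ContinuousOn K₂ Ω) (hlam₂ : ContinuousOn lam₂ Ω)
    (hR : ContinuousOn R Ω)
    (hlam₂0 : ∀ x ∈ Ω, 0 ≤ lam₂ x)
    (hsub : ∀ x ∈ Ω,
      f₂ x * ‖gradient u₂ x‖ ≤ K₂ x + lam₂ x * (R x + u₁ x - u₂ x))
    (T : ℝ) (hT : 0 ≤ T)
    (y y' : ℝ → EuclideanSpace ℝ (Fin 2))
    (hyΩ : ∀ s ∈ Set.Icc (0:ℝ) T, y s ∈ Ω)
    (hy : ∀ s ∈ Set.Icc (0:ℝ) T, HasDerivAt y (y' s) s)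
    (hy' : ContinuousOn y' (Set.Icc 0 T))
    (hspeed : ∀ s ∈ Set.Icc (0:ℝ) T, ‖y' s‖ ≤ f₂ (y s))
    (Λ : ℝ → ℝ) (hΛ : ∀ s, Λ s = ∫ τ in (0:ℝ)..s, lam₂ (y τ)) :
    u₂ (y 0) ≤
      (∫ s in (0:ℝ)..T,
        Real.exp (-Λ s) * (K₂ (y s) + lam₂ (y s) * (R (y s) + u₁ (y s))))
      + Real.exp (-Λ T) * u₂ (y T) := by
  have hyc : ContinuousOn y (Icc 0 T) := fun s hs => (hy s hs).continuousAt.continuousWithinAt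
  have hlamc : ContinuousOn (fun s => lam₂ (y s)) (Icc 0 T) := hlam₂.comp hyc hyΩ
  have hlamint : IntervalIntegrable (fun s => lam₂ (y s)) MeasureTheory.volume 0 T :=
    hlamc.intervalIntegrable_of_Icc hT
  have hu₂c : ContinuousOn (fun s => u₂ (y s)) (Icc 0 T) :=
    ContinuousOn.comp (fun x hx => (hu₂ x hx).continuousAt.continuousWithinAt) hyc hyΩ
  have hΛc : ContinuousOn Λ (Icc 0 T) := by
    rw [funext hΛ, ← uIcc_of_le hT]
    exact intervalIntegral.continuousOn_primitive_interval' hlamint left_mem_uIcc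
  have hexpc : ContinuousOn (fun s => Real.exp (-Λ s)) (Icc 0 T) := hΛc.neg.rexp
  have hcost : ContinuousOn (fun s =>
      Real.exp (-Λ s) * (K₂ (y s) + lam₂ (y s) * (R (y s) + u₁ (y s)))) (Icc 0 T) :=
    hexpc.mul ((hK₂.comp hyc hyΩ).add
      (hlamc.mul ((hR.comp hyc hyΩ).add (hu₁.comp hyc hyΩ))))
  have hΛd : ∀ s ∈ Ioo (0:ℝ) T, HasDerivAt Λ (lam₂ (y s)) s := by
    intro s hs
    rw [funext hΛ]
    refine intervalIntegral.integral_hasDerivAt_right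
      (hlamint.mono_set ?_)
      ((hlamc.mono Ioo_subset_Icc_self).stronglyMeasurableAtFilter isOpen_Ioo s hs)
      (hlamc.continuousAt (Icc_mem_nhds hs.1 hs.2))
    rw [uIcc_of_le hs.1.le, uIcc_of_le hT]
    exact Icc_subset_Icc_right hs.2.le
  have hderiv : ∀ s ∈ Ioo (0:ℝ) T, HasDerivAt (fun s => -(Real.exp (-Λ s) * u₂ (y s)))
      (-(Real.exp (-Λ s) * -lam₂ (y s) * u₂ (y s)
        + Real.exp (-Λ s) * inner ℝ (gradient u₂ (y s)) (y' s))) s := by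
    intro s hs
    have hs' := Ioo_subset_Icc_self hs
    have hcomp := (hu₂ _ (hyΩ s hs')).hasGradientAt.hasFDerivAt.comp_hasDerivAt s (hy s hs')
    rw [InnerProductSpace.toDual_apply_apply] at hcomp
    exact ((hΛd s hs).neg.exp.mul hcomp).neg
  have key := intervalIntegral.sub_le_integral_of_hasDeriv_right_of_le hT (hexpc.mul hu₂c).neg
    (fun s hs => (hderiv s hs).hasDerivWithinAt) hcost.integrableOn_Icc (by
      intro s hs
      have hs' := Ioo_subset_Icc_self hs
      have hinner := neg_le_of_abs_le
        (abs_real_inner_le_norm (gradient u₂ (y s)) (y' s))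
      have hgrad := mul_le_mul_of_nonneg_left (hspeed s hs') (norm_nonneg (gradient u₂ (y s)))
      have hbound : lam₂ (y s) * u₂ (y s) - inner ℝ (gradient u₂ (y s)) (y' s) ≤
          K₂ (y s) + lam₂ (y s) * (R (y s) + u₁ (y s)) := by
        linarith [hsub _ (hyΩ s hs')]
      linarith [mul_le_mul_of_nonneg_left hbound (Real.exp_pos (-Λ s)).le])
  have hΛ0 : Λ 0 = 0 := by rw [hΛ, intervalIntegral.integral_same]
  simp only [Pi.neg_apply, Pi.mul_apply, hΛ0, neg_zero, Real.exp_zero, one_mul] at key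
  linarith
end

section
/- Let a, b ∈ ℝ, h_x, h_y > 0, and c > 0. Define g : ℝ → ℝ by g(U) = √( (max(U−a,0)/h_x)² + (max(U−b,0)/h_y)² ). Then there exists a unique U* ∈ ℝ with g(U*) = c; this U* satisfies U* > min(a,b); and U* is monotone in the data: if a ≤ a′ and b ≤ b′ and U*′ is the unique solution of the same equation with data (a′, b′), then U* ≤ U*′. -/
open Set

/-- The upwind gradient norm vanishes at or below both neighboring values. -/
lemma upwind_gradient_eq_zero {hx hy a b U : ℝ} (h : U ≤ min a b) :
    Real.sqrt ((max (U - a) 0 / hx) ^ 2 + (max (U - b) 0 / hy) ^ 2) = 0 := by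
  have ha : U - a ≤ 0 := sub_nonpos.2 (h.trans (min_le_left a b))
  have hb : U - b ≤ 0 := sub_nonpos.2 (h.trans (min_le_right a b))
  simp [max_eq_right ha, max_eq_right hb]

lemma max_sub_div_sq_le {h a a' U V : ℝ} (hh : 0 < h) (ha : a ≤ a') (hVU : V ≤ U) :
    (max (V - a') 0 / h) ^ 2 ≤ (max (U - a) 0 / h) ^ 2 := by
  gcongr

lemma max_sub_div_sq_lt {h a a' U V : ℝ} (hh : 0 < h) (ha : a ≤ a') (hVU : V < U)
    (haU : a < U) : (max (V - a') 0 / h) ^ 2 < (max (U - a) 0 / h) ^ 2 := by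
  have key : max (V - a') 0 < max (U - a) 0 :=
    lt_max_of_lt_left (max_lt (by linarith) (by linarith))
  gcongr

/-- Above the smaller neighboring value, the upwind gradient norm strictly decreases when the
central value decreases and the neighboring values do not. -/
lemma upwind_gradient_lt {hx hy a b a' b' U V : ℝ} (hhx : 0 < hx) (hhy : 0 < hy)
    (ha : a ≤ a') (hb : b ≤ b') (hVU : V < U) (hU : min a b < U) :
    Real.sqrt ((max (V - a') 0 / hx) ^ 2 + (max (V - b') 0 / hy) ^ 2) <
      Real.sqrt ((max (U - a) 0 / hx) ^ 2 + (max (U - b) 0 / hy) ^ 2) := by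
  apply Real.sqrt_lt_sqrt (by positivity)
  rcases min_lt_iff.1 hU with h | h
  · exact add_lt_add_of_lt_of_le (max_sub_div_sq_lt hhx ha hVU h)
      (max_sub_div_sq_le hhy hb hVU.le)
  · exact add_lt_add_of_le_of_lt (max_sub_div_sq_le hhx ha hVU.le)
      (max_sub_div_sq_lt hhy hb hVU h)

/-- The upwind gradient norm attains every nonnegative value. -/
lemma exists_upwind_gradient_eq {hx hy c : ℝ} (hhx : 0 < hx) (hc : 0 ≤ c) (a b : ℝ) :
    ∃ U : ℝ, Real.sqrt ((max (U - a) 0 / hx) ^ 2 + (max (U - b) 0 / hy) ^ 2) = c := by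
  have hle : min a b ≤ a + c * hx :=
    (min_le_left a b).trans (le_add_of_nonneg_right (by positivity))
  have hcont : Continuous fun U : ℝ =>
      Real.sqrt ((max (U - a) 0 / hx) ^ 2 + (max (U - b) 0 / hy) ^ 2) := by fun_prop
  obtain ⟨U, -, hU⟩ := intermediate_value_Icc hle hcont.continuousOn
    (show c ∈ Icc _ _ from ⟨by simpa only [upwind_gradient_eq_zero le_rfl] using hc, by
      apply Real.le_sqrt_of_sq_le
      have hmax : max (a + c * hx - a) 0 / hx = c := by
        rw [add_sub_cancel_left, max_eq_left (by positivity), mul_div_cancel_right₀ c hhx.ne']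
      rw [hmax]
      exact le_add_of_nonneg_right (sq_nonneg _)⟩)
  exact ⟨U, hU⟩

/-- Solvability, causality (`U* > min(a,b)`), and monotonicity of the upwind
finite-difference update for the Eikonal equation on a grid with spacings
`h_x`, `h_y`. -/
theorem eikonal_update_solvable_causal_monotone
    (hx hy : ℝ) (hhx : 0 < hx) (hhy : 0 < hy) (c : ℝ) (hc : 0 < c)
    (g : ℝ → ℝ → ℝ → ℝ)
    (hg : ∀ a b U, g a b U =
      Real.sqrt ((max (U - a) 0 / hx) ^ 2 + (max (U - b) 0 / hy) ^ 2))
    (a b : ℝ) :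
    (∃! U : ℝ, g a b U = c) ∧
    (∀ U : ℝ, g a b U = c → min a b < U) ∧
    (∀ a' b' U U' : ℝ, a ≤ a' → b ≤ b' →
      g a b U = c → g a' b' U' = c → U ≤ U') := by
  have causal : ∀ U : ℝ, g a b U = c → min a b < U := by
    intro U hU
    by_contra! h
    rw [hg, upwind_gradient_eq_zero h] at hU
    exact hc.ne hU
  have mono : ∀ a' b' U U' : ℝ, a ≤ a' → b ≤ b' →
      g a b U = c → g a' b' U' = c → U ≤ U' := by
    intro a' b' U U' ha hb hU hU'
    by_contra! h
    have hlt := upwind_gradient_lt hhx hhy ha hb h (causal U hU)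
    rw [← hg, ← hg, hU, hU'] at hlt
    exact lt_irrefl c hlt
  refine ⟨?_, causal, mono⟩
  obtain ⟨U, hU⟩ := exists_upwind_gradient_eq (hy := hy) hhx hc.le a b
  rw [← hg] at hU
  exact ⟨U, hU, fun V hV =>
    le_antisymm (mono a b V U le_rfl le_rfl hV hU) (mono a b U V le_rfl le_rfl hU hV)⟩
end

section
/- Let a, b, v ∈ ℝ, h_x, h_y > 0, c ∈ ℝ, and μ > 0. Define g : ℝ → ℝ by g(U) = √( (max(U−a,0)/h_x)² + (max(U−b,0)/h_y)² ). Then there exists a unique U* ∈ ℝ with g(U*) = c − μ (U* − v). -/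
open Set

/-- A continuous nondecreasing function meets a line of negative slope exactly once. -/
theorem Monotone.existsUnique_eq_sub_mul {g : ℝ → ℝ} (hmono : Monotone g) (hcont : Continuous g)
    (c v : ℝ) {μ : ℝ} (hμ : 0 < μ) : ∃! U : ℝ, g U = c - μ * (U - v) := by
  obtain ⟨t, ht, hμt⟩ : ∃ t, 0 ≤ t ∧ μ * t = |g v - c| :=
    ⟨|g v - c| / μ, by positivity, mul_div_cancel₀ _ hμ.ne'⟩
  have hzero : (0 : ℝ) ∈ Icc (g (v - t) + μ * (v - t - v) - c)
      (g (v + t) + μ * (v + t - v) - c) := by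
    have hlower : g (v - t) ≤ g v := hmono (by linarith)
    have hupper : g v ≤ g (v + t) := hmono (by linarith)
    constructor
    · linarith [le_abs_self (g v - c)]
    · linarith [neg_abs_le (g v - c)]
  have hcontinuous : Continuous fun U => g U + μ * (U - v) - c := by fun_prop
  obtain ⟨U, -, hU⟩ := intermediate_value_Icc (by linarith : v - t ≤ v + t)
    hcontinuous.continuousOn hzero
  have hstrict : StrictMono fun W => g W + μ * (W - v) := fun x y hxy => by
    have hslope : μ * (x - v) < μ * (y - v) := by gcongr
    exact add_lt_add_of_le_of_lt (hmono hxy.le) hslope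
  refine ⟨U, by linarith, fun W hW => hstrict.injective ?_⟩
  dsimp only at hU ⊢
  linarith

/-- Unique solvability of the discretized coupled Hamilton–Jacobi–Bellman update
for mode 1 of the breakdown model: the equation
`√((max(U-a,0)/h_x)² + (max(U-b,0)/h_y)²) = c - μ (U - v)` has a unique solution,
since its left side is nondecreasing and its right side is strictly decreasing
in `U`. -/
theorem coupled_hjb_update_unique_solvable
    (a b v : ℝ) (hx hy : ℝ) (hhx : 0 < hx) (hhy : 0 < hy)
    (c : ℝ) (μ : ℝ) (hμ : 0 < μ)
    (g : ℝ → ℝ)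
    (hg : ∀ U, g U =
      Real.sqrt ((max (U - a) 0 / hx) ^ 2 + (max (U - b) 0 / hy) ^ 2)) :
    ∃! U : ℝ, g U = c - μ * (U - v) := by
  obtain rfl : g = _ := funext hg
  refine Monotone.existsUnique_eq_sub_mul (fun x y hxy => ?_) (by fun_prop) c v hμ
  gcongr
end
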